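/- arXiv:0805.0557 — 2 statements merged into one kernel-verified Lean document; each statement's English description precedes it below -/
import Mathlib

section
/- Let H : ℝ → [0,∞] be measurable with ∫_ℝ H(x) dx ≥ 1, and let F, G : ℝ → [0,∞] be measurable with F(x) ≥ G(x) + ∫_ℝ H(x − y) F(y) dy for all x ∈ ℝ. If there is a constant g > 0 with G(x) ≥ g for all x ∈ ℝ, then F(x) = ∞ for every x ∈ ℝ. -/
open scoped ENNReal
open MeasureTheory

/-- A function satisfying a renewal inequality with kernel of mass at least one and forcing term
bounded below by `g` dominates every multiple of `g`. -/
theorem natCast_mul_le_of_renewal {H F G : ℝ → ℝ≥0∞} (hH : Measurable H)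
    (hHint : 1 ≤ ∫⁻ x, H x) (hren : ∀ x : ℝ, G x + (∫⁻ y, H (x - y) * F y) ≤ F x)
    {g : ℝ≥0∞} (hGg : ∀ x, g ≤ G x) (n : ℕ) (x : ℝ) : n * g ≤ F x := by
  induction n generalizing x with
  | zero => simp
  | succ n ih =>
    calc ((n + 1 : ℕ) : ℝ≥0∞) * g = g + 1 * (n * g) := by push_cast; ring
      _ ≤ G x + (∫⁻ y, H (x - y)) * (n * g) := by
        rw [lintegral_sub_left_eq_self H x]
        gcongr
        exact hGg x
      _ = G x + ∫⁻ y, H (x - y) * (n * g) := by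
        rw [lintegral_mul_const _ (by fun_prop)]
      _ ≤ G x + ∫⁻ y, H (x - y) * F y := by
        gcongr with y
        exact ih y
      _ ≤ F x := hren x

theorem stmt_7 (H F G : ℝ → ℝ≥0∞) (hH : Measurable H) (hF : Measurable F)
    (hG : Measurable G) (hHint : 1 ≤ ∫⁻ x, H x)
    (hren : ∀ x : ℝ, G x + (∫⁻ y, H (x - y) * F y) ≤ F x)
    (g : ℝ≥0∞) (hg : 0 < g) (hGg : ∀ x, g ≤ G x) :
    ∀ x : ℝ, F x = ∞ := by
  intro x
  by_contra hx
  obtain ⟨n, hn⟩ := ENNReal.exists_nat_mul_gt hg.ne' hx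
  exact hn.not_ge (natCast_mul_le_of_renewal hH hHint hren hGg n x)
end

section
/- Let H : ℝ → [0,∞] be measurable with r := ∫_ℝ H(x) dx satisfying r ≥ 1. Let F : ℝ → [0,∞] be measurable, and let g, c be constants with 0 ≤ c < g < ∞. Suppose that F(x) + c ≥ g + ∫_ℝ H(x − y) F(y) dy for all x ∈ ℝ. Then F(x) = ∞ for every x ∈ ℝ. -/
open scoped ENNReal
open MeasureTheory

theorem stmt_8 (H F : ℝ → ℝ≥0∞) (hH : Measurable H) (hF : Measurable F)
    (hHint : 1 ≤ ∫⁻ x, H x)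
    (g c : ℝ≥0∞) (hcg : c < g) (hg : g < ∞)
    (hren : ∀ x : ℝ, g + (∫⁻ y, H (x - y) * F y) ≤ F x + c) :
    ∀ x : ℝ, F x = ∞ := by
  have lower_bound (n : ℕ) : ∀ x, n * (g - c) ≤ F x := by
    induction n with
    | zero => simp
    | succ n ih =>
      intro x
      have conv_ge : n * (g - c) ≤ ∫⁻ y, H (x - y) * F y :=
        calc (n : ℝ≥0∞) * (g - c) ≤ (∫⁻ y, H y) * (n * (g - c)) := le_mul_of_one_le_left' hHint
          _ = (∫⁻ y, H (x - y)) * (n * (g - c)) := by rw [lintegral_sub_left_eq_self H x]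
          _ = ∫⁻ y, H (x - y) * (n * (g - c)) :=
            (lintegral_mul_const _ (hH.comp (measurable_const.sub measurable_id))).symm
          _ ≤ ∫⁻ y, H (x - y) * F y := lintegral_mono fun y ↦ by gcongr; exact ih y
      refine (ENNReal.add_le_add_iff_right (hcg.trans hg).ne).1 ?_
      calc ((n + 1 : ℕ) : ℝ≥0∞) * (g - c) + c = (g - c + c) + n * (g - c) := by push_cast; ring
        _ = g + n * (g - c) := by rw [tsub_add_cancel_of_le hcg.le]
        _ ≤ g + ∫⁻ y, H (x - y) * F y := by gcongr
        _ ≤ F x + c := hren x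
  intro x
  by_contra hx
  obtain ⟨n, hn⟩ := ENNReal.exists_nat_mul_gt (tsub_pos_of_lt hcg).ne' hx
  exact (lower_bound n x).not_gt hn
end
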